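/- arXiv:2006.03675 — 3 statements merged into one kernel-verified Lean document; each statement's English description precedes it below -/
import Mathlib

section
/- Let G be a connected finite simple graph on n vertices with a distinguished vertex core, and let f : ℕ → V → ℕ∞ be the synchronous announcement-flooding distance estimates: f 0 core = 0, f 0 v = ⊤ for v ≠ core, and f (k+1) v = min (f k v) (⨅_{u adjacent to v} (f k u + 1)). Then for every k ≥ n − 1 and every vertex v, f k v = G.edist core v. That is, the distance information from the core announcement converges at every broker after at most n − 1 rounds. (Part of Theorem 2: the mesh-deployment information converges after a finite period of time.) -/
/-- Theorem 2 (convergence): in a connected overlay of `n` brokers, the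
flooded distance estimates converge to the true shortest distances to the core
after at most `n - 1` rounds. -/
theorem flooding_converges_in_n_minus_one_rounds
    {V : Type*} [Fintype V]
    (G : SimpleGraph V) (hG : G.Connected) (core : V)
    (n : ℕ) (hn : n = Fintype.card V)
    (f : ℕ → V → ℕ∞)
    (h0core : f 0 core = 0)
    (h0 : ∀ v, v ≠ core → f 0 v = ⊤)
    (hstep : ∀ k v, f (k + 1) v =
      min (f k v) (⨅ u : {u : V // G.Adj v u}, (f k u.1 + 1))) :
    ∀ k, n - 1 ≤ k → ∀ v, f k v = G.edist core v := by
  have lower : ∀ k v, G.edist core v ≤ f k v := by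
    intro k
    induction k with
    | zero =>
      intro v
      by_cases h : v = core
      · subst h; simp
      · rw [h0 v h]; exact le_top
    | succ k ih =>
      intro v
      rw [hstep]
      refine le_min (ih v) (le_iInf fun u => ?_)
      have h1 : G.edist u.1 v = 1 := SimpleGraph.edist_eq_one_iff_adj.2 u.2.symm
      calc G.edist core v ≤ G.edist core u.1 + G.edist u.1 v := SimpleGraph.edist_triangle
        _ ≤ f k u.1 + 1 := by rw [h1]; exact add_le_add (ih u.1) le_rfl
  have mono : ∀ k v, f (k + 1) v ≤ f k v := fun k v => by
    rw [hstep]; exact min_le_left _ _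
  have core0 : ∀ k, f k core = 0 := by
    intro k
    induction k with
    | zero => exact h0core
    | succ k ih => exact le_antisymm (ih ▸ mono k core) zero_le
  have upper : ∀ (v w : V) (p : G.Walk v w), w = core →
      ∀ k, p.length ≤ k → f k v ≤ (p.length : ℕ∞) := by
    intro v w p
    induction p with
    | nil => intro h k _; rw [h, core0]; exact zero_le
    | cons hadj q ih =>
      intro h k hk
      rw [SimpleGraph.Walk.length_cons] at hk ⊢
      obtain ⟨j, rfl⟩ : ∃ j, k = j + 1 := ⟨k - 1, by omega⟩
      rw [hstep]
      refine (min_le_right _ _).trans ((iInf_le _ ⟨_, hadj⟩).trans ?_)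
      push_cast
      exact add_le_add (ih h j (by omega)) le_rfl
  intro k hk v
  refine le_antisymm ?_ (lower k v)
  obtain ⟨p, hp, hd⟩ := hG.exists_path_of_dist v core
  have hl := hp.length_lt
  have := upper v core p rfl k (by omega)
  rwa [hd, (hG v core).coe_dist_eq_edist, SimpleGraph.edist_comm] at this
end

section
/- Let G be a finite simple graph with a distinguished vertex core, and let f : ℕ → V → ℕ∞ be the synchronous announcement-flooding distance estimates: f 0 core = 0, f 0 v = ⊤ for v ≠ core, and f (k+1) v = min (f k v) (⨅_{u adjacent to v} (f k u + 1)). Then for every vertex v, the set of rounds k at which v's estimate strictly improves, {k : f (k+1) v < f k v}, has at most one element. That is, each broker updates (and hence forwards) an improved distance to the core at most once, which underlies the bound that each link carries the announcement at most twice. -/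
theorem iInf_two_valued {ι : Type*} (g : ι → ℕ∞) (c : ℕ∞)
    (h : ∀ i, g i = c ∨ g i = ⊤) : (⨅ i, g i) = c ∨ (⨅ i, g i) = ⊤ := by
  by_cases hc : ∃ i, g i = c
  · left
    obtain ⟨i, hi⟩ := hc
    apply le_antisymm
    · exact hi ▸ iInf_le g i
    · refine le_iInf fun j => ?_
      rcases h j with hj | hj <;> simp [hj]
  · right
    push Not at hc
    rw [iInf_eq_top]
    exact fun i => (h i).resolve_left (hc i)

/-- Each broker's flooded distance estimate strictly improves at most once:
the set of rounds at which the estimate strictly decreases is a subsingleton. -/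
theorem flooding_improves_at_most_once
    {V : Type*} [Fintype V]
    (G : SimpleGraph V) (core : V)
    (f : ℕ → V → ℕ∞)
    (h0core : f 0 core = 0)
    (h0 : ∀ v, v ≠ core → f 0 v = ⊤)
    (hstep : ∀ k v, f (k + 1) v =
      min (f k v) (⨅ u : {u : V // G.Adj v u}, (f k u.1 + 1))) :
    ∀ v : V, {k : ℕ | f (k + 1) v < f k v}.Subsingleton := by
  -- key invariant
  have key : ∀ k : ℕ, (∀ v, f k v ≤ (k : ℕ∞) ∨ f k v = ⊤) ∧
      ∀ v, f (k + 1) v = f k v ∨ (f k v = ⊤ ∧ f (k + 1) v = ((k + 1 : ℕ) : ℕ∞)) := by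
    intro k
    induction k with
    | zero =>
      have hz : ∀ v, f 0 v = 0 ∨ f 0 v = ⊤ := by
        intro v
        by_cases hv : v = core
        · left; rw [hv, h0core]
        · right; exact h0 v hv
      refine ⟨fun v => (hz v).imp (fun h => by simp [h]) id, fun v => ?_⟩
      rw [hstep 0 v]
      rcases hz v with hv | hv
      · left; simp [hv]
      · rw [hv]
        rcases iInf_two_valued (fun u : {u : V // G.Adj v u} => f 0 u.1 + 1) 1
          (fun u => by rcases hz u.1 with h | h <;> simp [h]) with h | h
        · right; simp [h]
        · left; simp [h]
    | succ k ih =>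
      obtain ⟨ihb, ihs⟩ := ih
      have hb : ∀ v, f (k + 1) v ≤ ((k + 1 : ℕ) : ℕ∞) ∨ f (k + 1) v = ⊤ := by
        intro v
        rcases ihs v with h | ⟨-, h⟩
        · rw [h]
          exact (ihb v).imp (fun h => h.trans (by exact_mod_cast Nat.le_succ k)) id
        · left; rw [h]
      refine ⟨hb, fun v => ?_⟩
      rw [hstep (k + 1) v]
      by_cases hv : f (k + 1) v = ⊤
      · have hn : ∀ u : {u : V // G.Adj v u}, f k u.1 = ⊤ := by
          have h := hstep k v
          rw [hv] at h
          have h2 := (min_eq_top.mp h.symm).2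
          rw [iInf_eq_top] at h2
          intro u
          have := h2 u
          simpa using this
        rw [hv]
        rcases iInf_two_valued (fun u : {u : V // G.Adj v u} => f (k + 1) u.1 + 1)
          ((k + 1 + 1 : ℕ) : ℕ∞)
          (fun u => by
            rcases ihs u.1 with h | ⟨-, h⟩
            · right; simp [h, hn u]
            · left; rw [h]; push_cast; rfl) with h | h
        · right; refine ⟨rfl, ?_⟩; rw [h]; simp
        · left; rw [h]; simp
      · left
        refine min_eq_left (le_iInf fun u => ?_)
        rcases ihs u.1 with h | ⟨-, h⟩
        · rw [h, hstep k v]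
          exact (min_le_right _ _).trans (iInf_le _ u)
        · rw [h]
          exact ((hb v).resolve_right hv).trans le_self_add
  have anti : ∀ v, Antitone fun k => f k v := fun v =>
    antitone_nat_of_succ_le fun k => by rw [hstep k v]; exact min_le_left _ _
  intro v
  have top : ∀ k, f (k + 1) v < f k v → f k v = ⊤ := fun k hk =>
    ((key k).2 v).elim (fun h => absurd h hk.ne) (fun h => h.1)
  have no : ∀ a b, f (a + 1) v < f a v → f (b + 1) v < f b v → ¬ a < b := by
    intro a b ha hb hab
    have h1 : f b v ≤ f (a + 1) v := anti v hab
    rw [top b hb] at h1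
    exact absurd (lt_of_le_of_lt h1 ha) not_top_lt
  intro a ha b hb
  have h1 := no a b ha hb
  have h2 := no b a hb ha
  omega
end

section
/- Let G be a connected finite simple graph with a distinguished vertex core, let parent : V → V be a parent-selection function satisfying parent core = core and, for every v ≠ core, G.Adj v (parent v) and G.edist core (parent v) + 1 = G.edist core v, and let S be a finite set of vertices. Define the mesh M := ⋃_k M k where M 0 = S and M (k+1) = M k ∪ parent '' (M k). Then for every subscriber s ∈ S there exists a walk in G from core to s of length (G.edist core s).toNat all of whose vertices belong to M. Hence a publication injected at the core is delivered to every subscriber along a shortest path that stays entirely within the mesh. -/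
/-- Every subscriber is reached from the core by a walk of shortest-path
length all of whose vertices lie in the mesh: publications injected at the
core are delivered to every subscriber entirely within the mesh. -/
theorem publication_delivered_within_mesh
    {V : Type*} [Fintype V]
    (G : SimpleGraph V) (hG : G.Connected) (core : V)
    (parent : V → V)
    (hcore : parent core = core)
    (hadj : ∀ v, v ≠ core → G.Adj v (parent v))
    (hdist : ∀ v, v ≠ core → G.edist core (parent v) + 1 = G.edist core v)
    (S : Finset V)
    (M : ℕ → Set V)
    (hM0 : M 0 = ↑S)
    (hMs : ∀ k, M (k + 1) = M k ∪ parent '' (M k)) :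
    ∀ s ∈ S, ∃ w : G.Walk core s,
      w.length = (G.edist core s).toNat ∧
      ∀ v ∈ w.support, v ∈ ⋃ k, M k := by
  have key : ∀ n : ℕ, ∀ s ∈ ⋃ k, M k, G.edist core s = n →
      ∃ w : G.Walk core s, w.length = n ∧ ∀ v ∈ w.support, v ∈ ⋃ k, M k := by
    intro n
    induction n with
    | zero =>
      intro s hs h
      have h0 : core = s := by simpa using h
      subst h0
      refine ⟨SimpleGraph.Walk.nil, rfl, ?_⟩
      intro v hv
      have hv' : v = core := by simpa using hv
      rw [hv']
      exact hs
    | succ n ih =>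
      intro s hs h
      have hne : s ≠ core := by
        rintro rfl
        rw [SimpleGraph.edist_self] at h
        exact absurd (by exact_mod_cast h : 0 = n + 1) (by omega)
      have hp : parent s ∈ ⋃ k, M k := by
        obtain ⟨k, hk⟩ := Set.mem_iUnion.1 hs
        refine Set.mem_iUnion.2 ⟨k + 1, ?_⟩
        rw [hMs]
        exact Or.inr ⟨s, hk, rfl⟩
      have hd : G.edist core (parent s) = n := by
        have h1 := hdist s hne
        rw [h, Nat.cast_add, Nat.cast_one] at h1
        exact (ENat.add_left_injective_of_ne_top ENat.one_ne_top) h1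
      obtain ⟨w, hw, hv⟩ := ih _ hp hd
      refine ⟨w.concat (hadj s hne).symm, by simp [hw], ?_⟩
      intro v hv'
      rw [SimpleGraph.Walk.support_concat] at hv'
      rcases (by simpa using hv' : v ∈ w.support ∨ v = s) with h2 | h2
      · exact hv v h2
      · rw [h2]
        exact hs
  intro s hs
  refine key _ s (Set.mem_iUnion.2 ⟨0, ?_⟩) ?_
  · rw [hM0]
    exact hs
  · exact (ENat.coe_toNat (SimpleGraph.edist_ne_top_iff_reachable.2 (hG.preconnected core s))).symm
end
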